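/- There exists an absolute constant c_0 > 0 such that for every integer n ≥ 5 there is a 4-uniform hypergraph H on the vertex set {0,1,...,2^⌊2^(c_0·n)⌋ − 1} with the following two properties: (1) no 5-element vertex subset has all five of its 4-element subsets as edges of H (H is K_5^(4)-free), and (2) every subset of 2^6·n^5 + 1 vertices contains an edge of H (the independence number of H is at most 2^6·n^5). Consequently r_4(5, 2^6·n^5 + 1) > 2^⌊2^(c_0·n)⌋. -/

import Mathlib

/-- Forbidden colourings of a triple of levels `x < y < z` at which a path of the binary tree takes
the directions `d₁` at `z` and `d₂` at `y` (`true` means right). -/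
def Forbidden (φ : ℕ → ℕ → Bool) (d₁ d₂ : Bool) (x y z : ℕ) : Prop :=
  if d₁ = d₂ then φ x y = φ y z ∧ φ x z ≠ φ x y
  else if d₂ then φ x z = φ y z ∧ φ x y ≠ φ x z
  else φ x y = φ x z

/-- The condition for four increasing vertices, consecutive ones of which first differ at the
levels `a`, `b`, `c`, to form an edge. -/
def EdgePattern (φ : ℕ → ℕ → Bool) (a b c : ℕ) : Prop :=
  (a < b ∧ b < c ∧ Forbidden φ false false a b c) ∨
  (c < b ∧ b < a ∧ Forbidden φ true true c b a) ∨
  (b < a ∧ a < c ∧ Forbidden φ false true b a c) ∨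
  (b < c ∧ c < a ∧ Forbidden φ true false b c a)

theorem Forbidden.same {φ : ℕ → ℕ → Bool} {d : Bool} {x y z : ℕ} :
    Forbidden φ d d x y z ↔ φ x y = φ y z ∧ φ x z ≠ φ x y := by simp [Forbidden]

theorem Forbidden.left_right {φ : ℕ → ℕ → Bool} {x y z : ℕ} :
    Forbidden φ false true x y z ↔ φ x z = φ y z ∧ φ x y ≠ φ x z := by simp [Forbidden]

theorem Forbidden.right_left {φ : ℕ → ℕ → Bool} {x y z : ℕ} :
    Forbidden φ true false x y z ↔ φ x y = φ x z := by simp [Forbidden]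

theorem EdgePattern.cases {φ : ℕ → ℕ → Bool} {a b c : ℕ} (h : EdgePattern φ a b c) :
    (a < b ∧ b < c ∧ φ a b = φ b c ∧ φ a c ≠ φ a b) ∨
    (c < b ∧ b < a ∧ φ c b = φ b a ∧ φ c a ≠ φ c b) ∨
    (b < a ∧ a < c ∧ φ b c = φ a c ∧ φ b a ≠ φ b c) ∨
    (b < c ∧ c < a ∧ φ b c = φ b a) := by
  simpa only [EdgePattern, Forbidden.same, Forbidden.left_right, Forbidden.right_left] using h

theorem not_edgePattern_all_five (φ : ℕ → ℕ → Bool) (a b c d : ℕ)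
    (h₁ : EdgePattern φ a b c) (h₂ : EdgePattern φ b c d) (h₃ : EdgePattern φ (max a b) c d)
    (h₄ : EdgePattern φ a (max b c) d) (h₅ : EdgePattern φ a b (max c d)) : False := by
  have B (x y) : φ x y = true ∨ φ x y = false := by cases φ x y <;> simp
  replace h₁ := h₁.cases
  replace h₂ := h₂.cases
  replace h₃ := h₃.cases
  replace h₄ := h₄.cases
  replace h₅ := h₅.cases
  rcases h₁ with ⟨u, v, p, q⟩ | ⟨u, v, p, q⟩ | ⟨u, v, p, q⟩ | ⟨u, v, p⟩ <;>
  rcases h₂ with ⟨u', v', p', q'⟩ | ⟨u', v', p', q'⟩ | ⟨u', v', p', q'⟩ | ⟨u', v', p'⟩ <;>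
  first
  | (exfalso; omega)
  | (first
      | rw [max_eq_left (by omega : b ≤ a)] at h₃
      | rw [max_eq_right (by omega : a ≤ b)] at h₃
     first
      | rw [max_eq_left (by omega : c ≤ b)] at h₄
      | rw [max_eq_right (by omega : b ≤ c)] at h₄
     first
      | rw [max_eq_left (by omega : d ≤ c)] at h₅
      | rw [max_eq_right (by omega : c ≤ d)] at h₅
     rcases h₃ with ⟨u3, v3, p3, q3⟩ | ⟨u3, v3, p3, q3⟩ | ⟨u3, v3, p3, q3⟩ | ⟨u3, v3, p3⟩ <;>
     first
     | (exfalso; omega)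
     | (rcases h₄ with ⟨u4, v4, p4, q4⟩ | ⟨u4, v4, p4, q4⟩ | ⟨u4, v4, p4, q4⟩ | ⟨u4, v4, p4⟩ <;>
        first
        | (exfalso; omega)
        | (rcases h₅ with ⟨u5, v5, p5, q5⟩ | ⟨u5, v5, p5, q5⟩ | ⟨u5, v5, p5, q5⟩ | ⟨u5, v5, p5⟩ <;>
           first
           | (exfalso; omega)
           | grind)))

theorem not_alternating_seven (φ : ℕ → ℕ → Bool) (p : ℕ → ℕ) (d : ℕ → Bool)
    (h : ∀ i j k, i < j → j < k → k ≤ 6 → ¬ Forbidden φ (d i) (d j) (p k) (p j) (p i))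
    (hd : ∀ i, i < 6 → d (i+1) = !d i) : False := by
  have e1 := hd 0 (by norm_num)
  have e2 := hd 1 (by norm_num)
  have e3 := hd 2 (by norm_num)
  have e4 := hd 3 (by norm_num)
  have e5 := hd 4 (by norm_num)
  norm_num at e1 e2 e3 e4 e5
  have rl (i j k) (hij : i < j) (hjk : j < k) (hk : k ≤ 6) (hi : d i = true) (hj : d j = false) :
      φ (p k) (p j) ≠ φ (p k) (p i) := by
    simpa [hi, hj, Forbidden.right_left] using h i j k hij hjk hk
  have lr (i j k) (hij : i < j) (hjk : j < k) (hk : k ≤ 6) (hi : d i = false) (hj : d j = true) :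
      ¬ (φ (p k) (p i) = φ (p j) (p i) ∧ φ (p k) (p j) ≠ φ (p k) (p i)) := by
    simpa only [hi, hj, Forbidden.left_right] using h i j k hij hjk hk
  clear h hd
  cases h0 : d 0
  · simp only [h0, Bool.not_false] at e1
    simp only [e1, Bool.not_true] at e2
    simp only [e2, Bool.not_false] at e3
    simp only [e3, Bool.not_true] at e4
    simp only [e4, Bool.not_false] at e5
    have a1 := fun k hk hk' ↦ rl 1 2 k (by norm_num) hk hk' e1 e2
    have a2 := fun k hk hk' ↦ rl 1 4 k (by norm_num) hk hk' e1 e4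
    have a3 := fun k hk hk' ↦ rl 3 4 k (by norm_num) hk hk' e3 e4
    have b1 := fun k hk hk' ↦ lr 2 3 k (by norm_num) hk hk' e2 e3
    have b2 := lr 2 5 6 (by norm_num) (by norm_num) (by norm_num) e2 e5
    have b3 := fun k hk hk' ↦ lr 0 1 k (by norm_num) hk hk' h0 e1
    have b4 := fun k hk hk' ↦ lr 0 3 k (by norm_num) hk hk' h0 e3
    have b5 := lr 0 5 6 (by norm_num) (by norm_num) (by norm_num) h0 e5
    have a13 := a1 3 (by norm_num) (by norm_num)
    have a15 := a1 5 (by norm_num) (by norm_num)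
    have a16 := a1 6 (by norm_num) (by norm_num)
    have a25 := a2 5 (by norm_num) (by norm_num)
    have a26 := a2 6 (by norm_num) (by norm_num)
    have a35 := a3 5 (by norm_num) (by norm_num)
    have a36 := a3 6 (by norm_num) (by norm_num)
    have b15 := b1 5 (by norm_num) (by norm_num)
    have b16 := b1 6 (by norm_num) (by norm_num)
    have b33 := b3 3 (by norm_num) (by norm_num)
    have b35 := b3 5 (by norm_num) (by norm_num)
    have b36 := b3 6 (by norm_num) (by norm_num)
    have b45 := b4 5 (by norm_num) (by norm_num)
    have b46 := b4 6 (by norm_num) (by norm_num)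
    clear rl lr a1 a2 a3 b1 b3 b4
    have B (x y) : φ x y = true ∨ φ x y = false := by cases φ x y <;> simp
    grind
  · simp only [h0, Bool.not_true] at e1
    simp only [e1, Bool.not_false] at e2
    simp only [e2, Bool.not_true] at e3
    simp only [e3, Bool.not_false] at e4
    simp only [e4, Bool.not_true] at e5
    have a1 := fun k hk hk' ↦ rl 0 1 k (by norm_num) hk hk' h0 e1
    have a2 := fun k hk hk' ↦ rl 0 3 k (by norm_num) hk hk' h0 e3
    have a3 := fun k hk hk' ↦ rl 2 3 k (by norm_num) hk hk' e2 e3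
    have a4 := rl 4 5 6 (by norm_num) (by norm_num) (by norm_num) e4 e5
    have a5 := rl 0 5 6 (by norm_num) (by norm_num) (by norm_num) h0 e5
    have a12 := a1 2 (by norm_num) (by norm_num)
    have a14 := a1 4 (by norm_num) (by norm_num)
    have a16 := a1 6 (by norm_num) (by norm_num)
    have a24 := a2 4 (by norm_num) (by norm_num)
    have a26 := a2 6 (by norm_num) (by norm_num)
    have a34 := a3 4 (by norm_num) (by norm_num)
    have a36 := a3 6 (by norm_num) (by norm_num)
    have b1 := lr 1 2 4 (by norm_num) (by norm_num) (by norm_num) e1 e2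
    have b2 := lr 1 2 6 (by norm_num) (by norm_num) (by norm_num) e1 e2
    have b3 := lr 1 4 6 (by norm_num) (by norm_num) (by norm_num) e1 e4
    clear rl lr a1 a2 a3
    have B (x y) : φ x y = true ∨ φ x y = false := by cases φ x y <;> simp
    grind

/-- `u` and `v` agree above bit `b`, where `u` has a `0` and `v` has a `1`. -/
def SplitsAt (b u v : ℕ) : Prop :=
  (∀ i, b < i → u.testBit i = v.testBit i) ∧ u.testBit b = false ∧ v.testBit b = true

namespace SplitsAt

variable {a b u v w N : ℕ}

theorem lt (h : SplitsAt b u v) : u < v :=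
  Nat.lt_of_testBit b h.2.1 h.2.2 h.1

theorem exists_of_lt (h : u < v) : ∃ b, SplitsAt b u v := by
  have hne : u ^^^ v ≠ 0 := by
    rw [Ne, Nat.xor_eq_zero_iff]; exact h.ne
  obtain ⟨b, hb, hbi⟩ := Nat.exists_most_significant_bit hne
  have hab : ∀ i, b < i → u.testBit i = v.testBit i := fun i hi ↦ by
    simpa [Nat.testBit_xor] using hbi i hi
  rw [Nat.testBit_xor] at hb
  refine ⟨b, hab, ?_⟩
  cases hu : u.testBit b <;> cases hv : v.testBit b <;> simp [hu, hv] at hb ⊢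
  exact h.asymm (Nat.lt_of_testBit b hv hu fun i hi ↦ (hab i hi).symm)

theorem eq (h : SplitsAt a u v) (h' : SplitsAt b u v) : a = b := by
  rcases lt_trichotomy a b with hab | hab | hab
  · simpa [h'.2.1, h'.2.2] using h.1 b hab
  · exact hab
  · simpa [h.2.1, h.2.2] using h'.1 a hab

theorem trans (h : SplitsAt a u v) (h' : SplitsAt b v w) :
    a ≠ b ∧ SplitsAt (max a b) u w := by
  rcases lt_trichotomy a b with hab | rfl | hab
  · refine ⟨hab.ne, ?_⟩
    rw [max_eq_right hab.le]
    exact ⟨fun i hi ↦ (h.1 i (hab.trans hi)).trans (h'.1 i hi),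
      (h.1 b hab).trans h'.2.1, h'.2.2⟩
  · simpa [h.2.2] using h'.2.1
  · refine ⟨hab.ne', ?_⟩
    rw [max_eq_left hab.le]
    exact ⟨fun i hi ↦ (h.1 i hi).trans (h'.1 i (hab.trans hi)),
      h.2.1, (h'.1 a hab).symm.trans h.2.2⟩

theorem level_lt (h : SplitsAt b u v) (hv : v < 2 ^ N) : b < N := by
  by_contra! hb
  have := Nat.testBit_eq_false_of_lt (hv.trans_le (Nat.pow_le_pow_right (by norm_num) hb))
  simp [h.2.2] at this

theorem left_of_between (h : SplitsAt b u v) (huw : u ≤ w) (hwv : w ≤ v)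
    (hw : w.testBit b = false) : SplitsAt b w v := by
  rcases huw.eq_or_lt with rfl | huw
  · exact h
  rcases hwv.eq_or_lt with rfl | hwv
  · simp [h.2.2] at hw
  obtain ⟨i, hi⟩ := exists_of_lt huw
  obtain ⟨j, hj⟩ := exists_of_lt hwv
  obtain rfl := h.eq (hi.trans hj).2
  rcases max_choice i j with hij | hij <;> rw [hij] at hw ⊢
  · simp [hi.2.2] at hw
  · exact hj

theorem right_of_between (h : SplitsAt b u v) (huw : u ≤ w) (hwv : w ≤ v)
    (hw : w.testBit b = true) : SplitsAt b u w := by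
  rcases huw.eq_or_lt with rfl | huw
  · simp [h.2.1] at hw
  rcases hwv.eq_or_lt with rfl | hwv
  · exact h
  obtain ⟨i, hi⟩ := exists_of_lt huw
  obtain ⟨j, hj⟩ := exists_of_lt hwv
  obtain rfl := h.eq (hi.trans hj).2
  rcases max_choice i j with hij | hij <;> rw [hij] at hw ⊢
  · exact hi
  · simp [hj.2.1] at hw

end SplitsAt

/-- The hypergraph on `{0, …, 2 ^ N - 1}` defined from the colouring `φ` of the bit positions. -/
def stepUp (φ : ℕ → ℕ → Bool) (N : ℕ) : Set (Finset ℕ) :=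
  {e | ∃ v₁ v₂ v₃ v₄ a b c, SplitsAt a v₁ v₂ ∧ SplitsAt b v₂ v₃ ∧ SplitsAt c v₃ v₄ ∧
    EdgePattern φ a b c ∧ v₄ < 2 ^ N ∧ e = {v₁, v₂, v₃, v₄}}

theorem card_four {v₁ v₂ v₃ v₄ : ℕ} (h₁ : v₁ < v₂) (h₂ : v₂ < v₃) (h₃ : v₃ < v₄) :
    ({v₁, v₂, v₃, v₄} : Finset ℕ).card = 4 := by
  rw [Finset.card_insert_of_notMem (by simp; omega), Finset.card_insert_of_notMem (by simp; omega),
    Finset.card_pair h₃.ne]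

theorem stepUp.card_eq_and_subset {φ : ℕ → ℕ → Bool} {N : ℕ} {e : Finset ℕ}
    (he : e ∈ stepUp φ N) : e.card = 4 ∧ e ⊆ Finset.range (2 ^ N) := by
  obtain ⟨v₁, v₂, v₃, v₄, a, b, c, ha, hb, hc, -, hN, rfl⟩ := he
  have := ha.lt
  have := hb.lt
  have := hc.lt
  constructor
  · exact card_four ha.lt hb.lt hc.lt
  · intro x hx
    simp only [Finset.mem_insert, Finset.mem_singleton] at hx
    rw [Finset.mem_range]
    omega

theorem stepUp.edgePattern {φ : ℕ → ℕ → Bool} {N v₁ v₂ v₃ v₄ a b c : ℕ}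
    (ha : SplitsAt a v₁ v₂) (hb : SplitsAt b v₂ v₃) (hc : SplitsAt c v₃ v₄)
    (he : ({v₁, v₂, v₃, v₄} : Finset ℕ) ∈ stepUp φ N) : EdgePattern φ a b c := by
  obtain ⟨w₁, w₂, w₃, w₄, a', b', c', ha', hb', hc', hE, -, h⟩ := he
  have h₁ := ha.lt
  have h₂ := hb.lt
  have h₃ := hc.lt
  have h₁' := ha'.lt
  have h₂' := hb'.lt
  have h₃' := hc'.lt
  have H (x) : (x = v₁ ∨ x = v₂ ∨ x = v₃ ∨ x = v₄) ↔ (x = w₁ ∨ x = w₂ ∨ x = w₃ ∨ x = w₄) := by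
    simpa using Finset.ext_iff.mp h x
  have e₁ : v₁ = w₁ := by
    have := H v₁; have := H w₁; omega
  have e₄ : v₄ = w₄ := by
    have := H v₄; have := H w₄; omega
  have e₂ : v₂ = w₂ := by
    have := H v₂; have := H w₂; omega
  have e₃ : v₃ = w₃ := by
    have := H v₃; have := H w₃; omega
  subst e₁ e₂ e₃ e₄
  rwa [ha.eq ha', hb.eq hb', hc.eq hc']

theorem stepUp.exists_notMem {φ : ℕ → ℕ → Bool} {N : ℕ} {S : Finset ℕ} (hS : S.card = 5) :
    ¬ ∀ e, e ⊆ S → e.card = 4 → e ∈ stepUp φ N := by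
  intro h
  have mono := (S.orderEmbOfFin hS).strictMono
  have mem := S.orderEmbOfFin_mem hS
  generalize S.orderEmbOfFin hS = f at mono mem
  have h01 : f 0 < f 1 := mono (by decide)
  have h12 : f 1 < f 2 := mono (by decide)
  have h23 : f 2 < f 3 := mono (by decide)
  have h34 : f 3 < f 4 := mono (by decide)
  have sub (i j k l : Fin 5) (hij : f i < f j) (hjk : f j < f k) (hkl : f k < f l) :
      ({f i, f j, f k, f l} : Finset ℕ) ∈ stepUp φ N := by
    exact h _ (by simp [Finset.insert_subset_iff, mem]) (card_four hij hjk hkl)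
  obtain ⟨a, ha⟩ := SplitsAt.exists_of_lt h01
  obtain ⟨b, hb⟩ := SplitsAt.exists_of_lt h12
  obtain ⟨c, hc⟩ := SplitsAt.exists_of_lt h23
  obtain ⟨d, hd⟩ := SplitsAt.exists_of_lt h34
  exact not_edgePattern_all_five φ a b c d
    (edgePattern ha hb hc (sub _ _ _ _ h01 h12 h23))
    (edgePattern hb hc hd (sub _ _ _ _ h12 h23 h34))
    (edgePattern (ha.trans hb).2 hc hd (sub _ _ _ _ (h01.trans h12) h23 h34))
    (edgePattern ha (hb.trans hc).2 hd (sub _ _ _ _ h01 (h12.trans h23) h34))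
    (edgePattern ha hb (hc.trans hd).2 (sub _ _ _ _ h01 h12 (h23.trans h34)))

/-- A node on a root-to-leaf path of the binary tree of bit strings: the vertex `off` leaves the
path at the bit position `lvl`, where the path takes bit `right`. -/
structure Turn where
  off : ℕ
  lvl : ℕ
  right : Bool

namespace Turn

/-- The vertex `u` follows the path at the turn `p`. -/
def Splits (p : Turn) (u : ℕ) : Prop :=
  match p.right with
  | false => SplitsAt p.lvl u p.off
  | true => SplitsAt p.lvl p.off u

variable {p q r : Turn} {u v x : ℕ}

theorem Splits.of_right (h : p.Splits u) (hp : p.right = true) : SplitsAt p.lvl p.off u := by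
  simpa [Splits, hp] using h

theorem Splits.of_left (h : p.Splits u) (hp : p.right = false) : SplitsAt p.lvl u p.off := by
  simpa [Splits, hp] using h

theorem Splits.lt_lvl (hu : p.Splits u) (hv : p.Splits v) (h : SplitsAt x u v) : x < p.lvl := by
  by_contra! hx
  have key : u.testBit x = v.testBit x := by
    cases hp : p.right
    · replace hu := hu.of_left hp
      replace hv := hv.of_left hp
      rcases hx.eq_or_lt with rfl | hx
      · rw [hu.2.1, hv.2.1]
      · rw [hu.1 x hx, hv.1 x hx]
    · replace hu := hu.of_right hp
      replace hv := hv.of_right hp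
      rcases hx.eq_or_lt with rfl | hx
      · rw [hu.2.2, hv.2.2]
      · rw [← hu.1 x hx, ← hv.1 x hx]
  simp [h.2.1, h.2.2] at key

end Turn

/-- `C` is a set of turns on a path below which all elements of `T ⊆ S` lie, and all vertices
leaving the path at these turns belong to `S`. -/
structure IsPath (S T : Finset ℕ) (C : Finset Turn) : Prop where
  subset : T ⊆ S
  off_mem : ∀ p ∈ C, p.off ∈ S
  splits : ∀ p ∈ C, ∀ u ∈ T, p.Splits u
  splits_off : ∀ p ∈ C, ∀ q ∈ C, p.lvl < q.lvl → q.Splits p.off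
  injOn : Set.InjOn Turn.lvl C

namespace IsPath

variable {φ : ℕ → ℕ → Bool} {N : ℕ} {S T : Finset ℕ} {C : Finset Turn}

theorem not_forbidden_of_splitsAt (hS : ∀ e ∈ stepUp φ N, ¬ e ⊆ S) (hN : S ⊆ Finset.range (2 ^ N))
    {q r : Turn} {x u v : ℕ} (hu : u ∈ S) (hv : v ∈ S) (hq : q.off ∈ S) (hr : r.off ∈ S)
    (hx : SplitsAt x u v) (hqu : q.Splits u) (hqv : q.Splits v) (hru : r.Splits u)
    (hrv : r.Splits v) (hrq : r.Splits q.off) (hxq : x < q.lvl) (hqr : q.lvl < r.lvl) :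
    ¬ Forbidden φ r.right q.right x q.lvl r.lvl := by
  intro hF
  have key {v₁ v₂ v₃ v₄ a b c : ℕ} (h₁ : v₁ ∈ S) (h₂ : v₂ ∈ S) (h₃ : v₃ ∈ S) (h₄ : v₄ ∈ S)
      (ha : SplitsAt a v₁ v₂) (hb : SplitsAt b v₂ v₃) (hc : SplitsAt c v₃ v₄)
      (hE : EdgePattern φ a b c) : False :=
    hS {v₁, v₂, v₃, v₄}
      ⟨v₁, v₂, v₃, v₄, a, b, c, ha, hb, hc, hE, Finset.mem_range.mp (hN h₄), rfl⟩
      (by simp [Finset.insert_subset_iff, *])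
  cases hdr : r.right <;> cases hdq : q.right <;> rw [hdr, hdq] at hF
  · exact key hu hv hq hr hx (hqv.of_left hdq) (hrq.of_left hdr) (.inl ⟨hxq, hqr, hF⟩)
  · exact key hq hu hv hr (hqu.of_right hdq) hx (hrv.of_left hdr)
      (.inr <| .inr <| .inl ⟨hxq, hqr, hF⟩)
  · exact key hr hu hv hq (hru.of_right hdr) hx (hqv.of_left hdq)
      (.inr <| .inr <| .inr ⟨hxq, hqr, hF⟩)
  · exact key hr hq hu hv (hrq.of_right hdr) (hqu.of_right hdq) hx
      (.inr <| .inl ⟨hxq, hqr, hF⟩)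

theorem not_forbidden (h : IsPath S T C) (hT : T.Nonempty) (hS : ∀ e ∈ stepUp φ N, ¬ e ⊆ S)
    (hN : S ⊆ Finset.range (2 ^ N)) {p q r : Turn} (hp : p ∈ C) (hq : q ∈ C) (hr : r ∈ C)
    (hpq : p.lvl < q.lvl) (hqr : q.lvl < r.lvl) :
    ¬ Forbidden φ r.right q.right p.lvl q.lvl r.lvl := by
  obtain ⟨u, hu⟩ := hT
  have hu' := h.subset hu
  have hps := h.splits p hp u hu
  have hqs := h.splits q hq u hu
  have hrs := h.splits r hr u hu
  have hqp := h.splits_off p hp q hq hpq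
  have hrp := h.splits_off p hp r hr (hpq.trans hqr)
  have hrq := h.splits_off q hq r hr hqr
  cases hdp : p.right
  · exact not_forbidden_of_splitsAt hS hN hu' (h.off_mem p hp) (h.off_mem q hq) (h.off_mem r hr)
      (hps.of_left hdp) hqs hqp hrs hrp hrq hpq hqr
  · exact not_forbidden_of_splitsAt hS hN (h.off_mem p hp) hu' (h.off_mem q hq) (h.off_mem r hr)
      (hps.of_right hdp) hqp hqs hrp hrs hrq hpq hqr

open Classical in
theorem insert_turn (h : IsPath S T C) {T' : Finset ℕ} {p : Turn} (hT : T' ⊆ T) (hp : p.off ∈ T)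
    (hsp : ∀ u ∈ T', p.Splits u) (hlt : ∀ q ∈ C, p.lvl < q.lvl) : IsPath S T' (insert p C) where
  subset := hT.trans h.subset
  off_mem := by
    simpa using ⟨h.subset hp, h.off_mem⟩
  splits := by
    simpa using ⟨hsp, fun q hq u hu ↦ h.splits q hq u (hT hu)⟩
  splits_off := by
    intro q hq r hr hqr
    rw [Finset.mem_insert] at hq hr
    rcases hq with rfl | hq <;> rcases hr with rfl | hr
    · exact absurd hqr (lt_irrefl _)
    · exact h.splits r hr _ hp
    · exact absurd hqr (hlt q hq).asymm
    · exact h.splits_off q hq r hr hqr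
  injOn := by
    rw [Finset.coe_insert, Set.injOn_insert]
    · refine ⟨h.injOn, ?_⟩
      rintro ⟨q, hq, hqp⟩
      exact (hlt q hq).ne' hqp
    · intro hp
      exact lt_irrefl _ (hlt p hp)

open Classical in
/-- A set with at least two elements is divided at its topmost branching position. -/
theorem exists_split (h : IsPath S T C) (hT : 1 < T.card) :
    ∃ (p₀ p₁ : Turn) (T₀ T₁ : Finset ℕ), p₀.right = false ∧ p₁.right = true ∧
      (∀ q ∈ C, p₀.lvl < q.lvl) ∧ (∀ q ∈ C, p₁.lvl < q.lvl) ∧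
      IsPath S T₀ (insert p₀ C) ∧ IsPath S T₁ (insert p₁ C) ∧
      T₀.Nonempty ∧ T₁.Nonempty ∧ T.card = T₀.card + T₁.card := by
  have hne : T.Nonempty := Finset.card_pos.mp (by omega)
  have hmin := T.min'_mem hne
  have hmax := T.max'_mem hne
  have hlt : T.min' hne < T.max' hne := Finset.min'_lt_max'_of_card T hT
  have hle (w) (hw : w ∈ T) : T.min' hne ≤ w ∧ w ≤ T.max' hne :=
    ⟨T.min'_le w hw, T.le_max' w hw⟩
  generalize T.min' hne = u at *
  generalize T.max' hne = v at *
  obtain ⟨x, hx⟩ := SplitsAt.exists_of_lt hlt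
  have hxC (q) (hq : q ∈ C) : x < q.lvl :=
    (h.splits q hq u hmin).lt_lvl (h.splits q hq v hmax) hx
  have h₀ (w) (hw : w ∈ T) (hwx : w.testBit x = false) : SplitsAt x w v :=
    hx.left_of_between (hle w hw).1 (hle w hw).2 hwx
  have h₁ (w) (hw : w ∈ T) (hwx : w.testBit x = true) : SplitsAt x u w :=
    hx.right_of_between (hle w hw).1 (hle w hw).2 hwx
  refine ⟨⟨v, x, false⟩, ⟨u, x, true⟩, T.filter (fun w ↦ w.testBit x = false),
    T.filter (fun w ↦ ¬ w.testBit x = false), rfl, rfl, hxC, hxC,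
    h.insert_turn (Finset.filter_subset _ _) hmax ?_ hxC,
    h.insert_turn (Finset.filter_subset _ _) hmin ?_ hxC, ⟨u, ?_⟩, ⟨v, ?_⟩, ?_⟩
  · intro w hw
    rw [Finset.mem_filter] at hw
    exact h₀ w hw.1 hw.2
  · intro w hw
    rw [Finset.mem_filter] at hw
    exact h₁ w hw.1 (by simpa using hw.2)
  · exact Finset.mem_filter.mpr ⟨hmin, hx.2.1⟩
  · exact Finset.mem_filter.mpr ⟨hmax, by simp [hx.2.2]⟩
  · exact (Finset.card_filter_add_card_filter_not _).symm

/-- A sequence of turns of `C` going down the path in alternating directions. -/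
structure Alternating (C : Finset Turn) (m : ℕ) (c : ℕ → Turn) : Prop where
  mem : ∀ i < m, c i ∈ C
  lvl_lt : ∀ i j, i < j → j < m → (c j).lvl < (c i).lvl
  right_succ : ∀ i, i + 1 < m → (c (i + 1)).right = !(c i).right

open Classical in
theorem Alternating.mono {m : ℕ} {c : ℕ → Turn} (h : Alternating C m c) (p : Turn) :
    Alternating (insert p C) m c :=
  ⟨fun i hi ↦ Finset.mem_insert_of_mem (h.mem i hi), h.lvl_lt, h.right_succ⟩

open Classical in
theorem Alternating.snoc {m : ℕ} {c : ℕ → Turn} (h : Alternating C (m + 1) c) {p : Turn}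
    (hlt : ∀ q ∈ C, p.lvl < q.lvl) (hp : p.right = !(c m).right) :
    Alternating (insert p C) (m + 2) (fun i ↦ if i ≤ m then c i else p) where
  mem i hi := by
    split_ifs with him
    · exact Finset.mem_insert_of_mem (h.mem i (by omega))
    · exact Finset.mem_insert_self _ _
  lvl_lt i j hij hj := by
    rw [if_pos (by omega : i ≤ m)]
    split_ifs with hjm
    · exact h.lvl_lt i j hij (by omega)
    · exact hlt _ (h.mem i (by omega))
  right_succ i hi := by
    rw [if_pos (by omega : i ≤ m)]
    split_ifs with hjm
    · exact h.right_succ i (by omega)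
    · rwa [show i = m by omega]

theorem Alternating.false_of_seven {c : ℕ → Turn} (hc : Alternating C 7 c) (h : IsPath S T C)
    (hT : T.Nonempty) (hS : ∀ e ∈ stepUp φ N, ¬ e ⊆ S) (hN : S ⊆ Finset.range (2 ^ N)) : False :=
  not_alternating_seven φ (fun i ↦ (c i).lvl) (fun i ↦ (c i).right)
    (fun i j k hij hjk hk ↦ h.not_forbidden hT hS hN (hc.mem k (by omega)) (hc.mem j (by omega))
      (hc.mem i (by omega)) (hc.lvl_lt j k hjk (by omega)) (hc.lvl_lt i j hij (by omega)))
    (fun i hi ↦ hc.right_succ i (by omega))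

open Classical in
theorem card_le {H : ℕ} (hS : ∀ e ∈ stepUp φ N, ¬ e ⊆ S) (hN : S ⊆ Finset.range (2 ^ N))
    (hH : ∀ T C, IsPath S T C → T.Nonempty → C.card < H) {h m r : ℕ} {c : ℕ → Turn}
    (hP : IsPath S T C) (hc : Alternating C (m + 1) c) (hh : C.card + h = H) (hm : m + r = 5) :
    T.card ≤ h ^ r := by
  induction h generalizing T C m r c with
  | zero =>
    rcases T.eq_empty_or_nonempty with rfl | hT
    · simp
    · have := hH T C hP hT
      omega
  | succ h ih =>
    rcases le_or_gt T.card 1 with hT | hT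
    · exact hT.trans (Nat.one_le_pow _ _ (by omega))
    obtain ⟨p₀, p₁, T₀, T₁, hp₀, hp₁, hlt₀, hlt₁, hP₀, hP₁, hT₀, hT₁, hcard⟩ := hP.exists_split hT
    have hC (p : Turn) (hp : ∀ q ∈ C, p.lvl < q.lvl) : (insert p C).card + h = H := by
      rw [Finset.card_insert_of_notMem fun hpC ↦ lt_irrefl _ (hp p hpC)]
      omega
    obtain ⟨r, rfl⟩ : ∃ r', r = r' + 1 := by
      rcases r with _ | r
      · exfalso
        obtain rfl : m = 5 := by omega
        cases hd : (c 5).right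
        · exact (hc.snoc hlt₁ (by simp [hp₁, hd])).false_of_seven hP₁ hT₁ hS hN
        · exact (hc.snoc hlt₀ (by simp [hp₀, hd])).false_of_seven hP₀ hT₀ hS hN
      · exact ⟨r, rfl⟩
    have key : h ^ (r + 1) + h ^ r ≤ (h + 1) ^ (r + 1) := by
      calc h ^ (r + 1) + h ^ r = h ^ r * (h + 1) := by ring
        _ ≤ (h + 1) ^ r * (h + 1) := by gcongr; omega
        _ = (h + 1) ^ (r + 1) := by ring
    cases hd : (c m).right
    · have b₀ := ih hP₀ (hc.mono p₀) (hC p₀ hlt₀) hm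
      have b₁ := ih hP₁ (hc.snoc hlt₁ (by simp [hp₁, hd])) (hC p₁ hlt₁) (r := r) (by omega)
      omega
    · have b₀ := ih hP₀ (hc.snoc hlt₀ (by simp [hp₀, hd])) (hC p₀ hlt₀) (r := r) (by omega)
      have b₁ := ih hP₁ (hc.mono p₁) (hC p₁ hlt₁) hm
      omega

theorem card_le_of_independent {H : ℕ} (hS : ∀ e ∈ stepUp φ N, ¬ e ⊆ S)
    (hN : S ⊆ Finset.range (2 ^ N)) (hH : ∀ T C, IsPath S T C → T.Nonempty → C.card < H) :
    S.card ≤ 2 * H ^ 5 := by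
  classical
  have hP : IsPath S S ∅ := by constructor <;> simp
  rcases S.eq_empty_or_nonempty with rfl | hne
  · simp
  have hpos : 0 < H := by simpa using hH S ∅ hP hne
  have hpow : 1 ≤ H ^ 5 := Nat.one_le_pow _ _ hpos
  rcases le_or_gt S.card 1 with hT | hT
  · omega
  obtain ⟨p₀, p₁, T₀, T₁, hp₀, hp₁, hlt₀, hlt₁, hP₀, hP₁, hT₀, hT₁, hcard⟩ := hP.exists_split hT
  have alt (p : Turn) : Alternating (insert p ∅) (0 + 1) (fun _ ↦ p) := by
    constructor
    · simp
    · intros; omega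
    · intros; omega
  have b₀ := card_le hS hN hH hP₀ (alt p₀) (h := H - 1) (r := 5) (by simp; omega) rfl
  have b₁ := card_le hS hN hH hP₁ (alt p₁) (h := H - 1) (r := 5) (by simp; omega) rfl
  have : (H - 1) ^ 5 ≤ H ^ 5 := by gcongr; omega
  omega

end IsPath

/-- All pairs between `U` and `V` point from `U` to `V` in the tournament defined by `φ`. -/
def Dominates (φ : ℕ → ℕ → Bool) (U V : Finset ℕ) : Prop :=
  ∀ u ∈ U, ∀ v ∈ V, (u < v → φ u v = true) ∧ (v < u → φ v u = false)

theorem exists_dominates {φ : ℕ → ℕ → Bool} {A : Finset ℕ} {t : ℕ}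
    (hA : ∀ x ∈ A, ∀ y ∈ A, ∀ z ∈ A, x < y → y < z → ¬ (φ x y = φ y z ∧ φ x z ≠ φ x y))
    (ht : 2 * t ≤ A.card) :
    ∃ U V : Finset ℕ, U ⊆ A ∧ V ⊆ A ∧ U.card = t ∧ V.card = t ∧ Disjoint U V ∧
      Dominates φ U V := by
  classical
  let prec (x y : ℕ) : Prop := (x < y ∧ φ x y = true) ∨ (y < x ∧ φ y x = false)
  have irrefl (x) : ¬ prec x x := by simp [prec]
  have total (x y) (hxy : x ≠ y) : prec x y ∨ prec y x := by
    simp only [prec]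
    rcases lt_or_gt_of_ne hxy with h | h
    · cases hφ : φ x y <;> simp [h]
    · cases hφ : φ y x <;> simp [h]
  have trans {x y z} (hx : x ∈ A) (hy : y ∈ A) (hz : z ∈ A) (hxy : prec x y) (hyz : prec y z) :
      prec x z := by
    have B (x y) : φ x y = true ∨ φ x y = false := by cases φ x y <;> simp
    have h₁ := hA x hx y hy z hz
    have h₂ := hA x hx z hz y hy
    have h₃ := hA y hy x hx z hz
    have h₄ := hA y hy z hz x hx
    have h₅ := hA z hz x hx y hy
    have h₆ := hA z hz y hy x hx
    simp only [prec] at *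
    grind
  let rank (x : ℕ) : ℕ := (A.filter fun y ↦ prec y x).card
  have rank_lt {x y} (hx : x ∈ A) (hy : y ∈ A) (hxy : prec x y) : rank x < rank y := by
    refine Finset.card_lt_card (Finset.ssubset_iff_of_subset ?_ |>.mpr ⟨x, ?_, ?_⟩)
    · intro z hz
      rw [Finset.mem_filter] at hz ⊢
      exact ⟨hz.1, trans hz.1 hx hy hz.2 hxy⟩
    · exact Finset.mem_filter.mpr ⟨hx, hxy⟩
    · exact fun h ↦ irrefl x (Finset.mem_filter.mp h).2
  have rank_inj : Set.InjOn rank A := by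
    intro x hx y hy hxy
    by_contra hne
    rcases total x y hne with h | h
    · exact (rank_lt hx hy h).ne hxy
    · exact (rank_lt hy hx h).ne' hxy
  have rank_image : A.image rank = Finset.range A.card := by
    apply Finset.eq_of_subset_of_card_le
    · intro k hk
      obtain ⟨x, hx, rfl⟩ := Finset.mem_image.mp hk
      rw [Finset.mem_range]
      exact Finset.card_lt_card (Finset.filter_ssubset.mpr ⟨x, hx, irrefl x⟩)
    · rw [Finset.card_range, Finset.card_image_of_injOn rank_inj]
  have card_slice (I : Finset ℕ) (hI : I ⊆ Finset.range A.card) :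
      (A.filter fun x ↦ rank x ∈ I).card = I.card := by
    rw [← Finset.card_image_of_injOn (f := rank) (rank_inj.mono <| Finset.coe_subset.mpr <|
      Finset.filter_subset _ _)]
    congr 1
    rw [← rank_image] at hI
    ext k
    constructor
    · intro hk
      obtain ⟨x, hx, rfl⟩ := Finset.mem_image.mp hk
      exact (Finset.mem_filter.mp hx).2
    · intro hk
      obtain ⟨x, hx, rfl⟩ := Finset.mem_image.mp (hI hk)
      exact Finset.mem_image_of_mem _ (Finset.mem_filter.mpr ⟨hx, hk⟩)
  refine ⟨A.filter fun x ↦ rank x ∈ Finset.range t, A.filter fun x ↦ rank x ∈ Finset.Ico t (2 * t),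
    Finset.filter_subset _ _, Finset.filter_subset _ _, ?_, ?_, ?_, ?_⟩
  · rw [card_slice _ (Finset.range_subset_range.mpr (by omega)), Finset.card_range]
  · rw [card_slice _ fun x hx ↦ ?_, Nat.card_Ico]
    · omega
    · simp only [Finset.mem_Ico, Finset.mem_range] at *
      omega
  · rw [Finset.disjoint_left]
    simp only [Finset.mem_filter, Finset.mem_range, Finset.mem_Ico]
    omega
  · intro u hu v hv
    simp only [Finset.mem_filter, Finset.mem_range, Finset.mem_Ico] at hu hv
    have huv : prec u v := by
      refine (total u v ?_).resolve_right fun h ↦ ?_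
      · rintro rfl
        omega
      · have := rank_lt hv.1 hu.1 h
        omega
    simp only [prec] at huv
    constructor <;> intro h
    · exact (huv.resolve_right fun h' ↦ h.asymm h'.1).2
    · exact (huv.resolve_left fun h' ↦ h.asymm h'.1).2

theorem card_filter_forall_mem_eq {α : Type*} [Fintype α] [DecidableEq α] (F : Finset α)
    (g : α → Bool) :
    (Finset.univ.filter fun f : α → Bool ↦ ∀ p ∈ F, f p = g p).card * 2 ^ F.card =
      2 ^ Fintype.card α := by
  have : (Finset.univ.filter fun f : α → Bool ↦ ∀ p ∈ F, f p = g p) =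
      Fintype.piFinset fun p ↦ if p ∈ F then {g p} else Finset.univ := by
    ext f
    simp only [Finset.mem_filter, Finset.mem_univ, true_and, Fintype.mem_piFinset]
    refine forall_congr' fun p ↦ ?_
    split_ifs with hp <;> simp [hp]
  rw [this, Fintype.card_piFinset]
  simp only [apply_ite Finset.card, Finset.card_singleton, Finset.card_univ, Fintype.card_bool]
  rw [Finset.prod_ite, Finset.prod_const_one, one_mul, Finset.prod_const, ← pow_add,
    Finset.filter_not, Finset.filter_mem_eq_inter, Finset.univ_inter, ← Finset.compl_eq_univ_sdiff,
    Finset.card_compl_add_card]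

/-- The colouring of `ℕ × ℕ` obtained from a colouring of `Fin N × Fin N`. -/
def extendColouring {N : ℕ} (f : Fin N × Fin N → Bool) (x y : ℕ) : Bool :=
  if h : x < N ∧ y < N then f (⟨x, h.1⟩, ⟨y, h.2⟩) else false

open Classical in
theorem card_dominates_le {N t : ℕ} {U V : Finset ℕ} (hU : U ⊆ Finset.range N)
    (hV : V ⊆ Finset.range N) (hUt : U.card = t) (hVt : V.card = t) (hd : Disjoint U V) :
    (Finset.univ.filter fun f : Fin N × Fin N → Bool ↦
      Dominates (extendColouring f) U V).card * 2 ^ (t * t) ≤ 2 ^ (N * N) := by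
  let F : Finset (Fin N × Fin N) := Finset.univ.filter fun p ↦ p.1 < p.2 ∧
    ((p.1 : ℕ) ∈ U ∧ (p.2 : ℕ) ∈ V ∨ (p.1 : ℕ) ∈ V ∧ (p.2 : ℕ) ∈ U)
  have hF : t * t ≤ F.card := by
    have hcard : (U ×ˢ V).card = t * t := by rw [Finset.card_product, hUt, hVt]
    rw [← hcard]
    refine Finset.card_le_card_of_surjOn
      (fun p ↦ if (p.1 : ℕ) ∈ U then ((p.1 : ℕ), (p.2 : ℕ)) else ((p.2 : ℕ), (p.1 : ℕ))) ?_
    rintro ⟨u, v⟩ huv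
    obtain ⟨hu, hv⟩ := Finset.mem_product.mp (Finset.mem_coe.mp huv)
    dsimp only at hu hv
    have huN := Finset.mem_range.mp (hU hu)
    have hvN := Finset.mem_range.mp (hV hv)
    have hvU : v ∉ U := Finset.disjoint_right.mp hd hv
    rcases lt_trichotomy u v with h | rfl | h
    · refine ⟨(⟨u, huN⟩, ⟨v, hvN⟩), ?_, ?_⟩
      · simp [F, h, hu, hv]
      · simp [hu]
    · exact absurd hu hvU
    · refine ⟨(⟨v, hvN⟩, ⟨u, huN⟩), ?_, ?_⟩
      · simp [F, h, hu, hv]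
      · simp [hvU]
  have key := card_filter_forall_mem_eq F fun p ↦ decide ((p.1 : ℕ) ∈ U)
  rw [Fintype.card_prod, Fintype.card_fin] at key
  rw [← key]
  refine Nat.mul_le_mul (Finset.card_le_card fun f hf ↦ ?_)
    (Nat.pow_le_pow_right (by norm_num) hF)
  · rw [Finset.mem_filter] at hf ⊢
    refine ⟨Finset.mem_univ _, fun ⟨⟨x, hx⟩, ⟨y, hy⟩⟩ hp ↦ ?_⟩
    replace hf := hf.2
    simp only [F, Finset.mem_filter, Finset.mem_univ, true_and, Fin.mk_lt_mk] at hp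
    rcases hp with ⟨hxy, ⟨h₁, h₂⟩ | ⟨h₁, h₂⟩⟩
    · simpa [extendColouring, hx, hy, h₁] using (hf x h₁ y h₂).1 hxy
    · have hxU : x ∉ U := Finset.disjoint_right.mp hd h₁
      simpa [extendColouring, hx, hy, hxU] using (hf y h₂ x h₁).2 hxy

theorem exists_colouring {N t : ℕ} (ht : 0 < t) (hN : N ^ 2 < 2 ^ t) :
    ∃ φ : ℕ → ℕ → Bool, ∀ U V : Finset ℕ, U ⊆ Finset.range N → V ⊆ Finset.range N →
      U.card = t → V.card = t → Disjoint U V → ¬ Dominates φ U V := by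
  classical
  by_contra! hcon
  let P := (Finset.powersetCard t (Finset.range N) ×ˢ Finset.powersetCard t (Finset.range N)).filter
    fun p ↦ Disjoint p.1 p.2
  have hcover : (Finset.univ : Finset (Fin N × Fin N → Bool)) ⊆ P.biUnion fun p ↦
      Finset.univ.filter fun f ↦ Dominates (extendColouring f) p.1 p.2 := by
    intro f _
    obtain ⟨U, V, hU, hV, hUt, hVt, hd, h⟩ := hcon (extendColouring f)
    simp only [Finset.mem_biUnion, Finset.mem_filter, Finset.mem_univ, true_and]
    refine ⟨(U, V), ?_, h⟩
    simp [P, Finset.mem_powersetCard, hU, hV, hUt, hVt, hd]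
  have hP : P.card ≤ N ^ t * N ^ t := by
    refine (Finset.card_filter_le _ _).trans ?_
    rw [Finset.card_product, Finset.card_powersetCard, Finset.card_range]
    exact Nat.mul_le_mul (Nat.choose_le_pow _ _) (Nat.choose_le_pow _ _)
  have h₁ : 2 ^ (N * N) * 2 ^ (t * t) ≤ N ^ t * N ^ t * 2 ^ (N * N) := by
    calc 2 ^ (N * N) * 2 ^ (t * t)
        = (Finset.univ : Finset (Fin N × Fin N → Bool)).card * 2 ^ (t * t) := by
          simp
      _ ≤ (∑ p ∈ P, (Finset.univ.filter fun f : Fin N × Fin N → Bool ↦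
            Dominates (extendColouring f) p.1 p.2).card) * 2 ^ (t * t) := by
          gcongr
          exact (Finset.card_le_card hcover).trans Finset.card_biUnion_le
      _ ≤ ∑ p ∈ P, 2 ^ (N * N) := by
          rw [Finset.sum_mul]
          refine Finset.sum_le_sum fun p hp ↦ ?_
          simp only [P, Finset.mem_filter, Finset.mem_product, Finset.mem_powersetCard] at hp
          exact card_dominates_le hp.1.1.1 hp.1.2.1 hp.1.1.2 hp.1.2.2 hp.2
      _ ≤ N ^ t * N ^ t * 2 ^ (N * N) := by
          rw [Finset.sum_const, smul_eq_mul]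
          gcongr
  have h₂ : N ^ t * N ^ t < 2 ^ (t * t) := by
    calc N ^ t * N ^ t = (N ^ 2) ^ t := by ring
      _ < (2 ^ t) ^ t := Nat.pow_lt_pow_left hN ht.ne'
      _ = 2 ^ (t * t) := by ring
  have h₃ : 0 < 2 ^ (N * N) := by positivity
  nlinarith

theorem IsPath.card_lt {φ : ℕ → ℕ → Bool} {N t : ℕ} {S T : Finset ℕ} {C : Finset Turn}
    (hφ : ∀ U V : Finset ℕ, U ⊆ Finset.range N → V ⊆ Finset.range N →
      U.card = t → V.card = t → Disjoint U V → ¬ Dominates φ U V)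
    (hS : ∀ e ∈ stepUp φ N, ¬ e ⊆ S) (hN : S ⊆ Finset.range (2 ^ N))
    (h : IsPath S T C) (hT : T.Nonempty) : C.card < 4 * t := by
  classical
  by_contra! hC
  have hlvl (p) (hp : p ∈ C) : p.lvl < N := by
    obtain ⟨u, hu⟩ := hT
    have hs := h.splits p hp u hu
    cases hd : p.right
    · exact (hs.of_left hd).level_lt (Finset.mem_range.mp (hN (h.off_mem p hp)))
    · exact (hs.of_right hd).level_lt (Finset.mem_range.mp (hN (h.subset hu)))
  obtain ⟨d, hd⟩ : ∃ d, 2 * t ≤ (C.filter fun p ↦ p.right = d).card := by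
    by_contra! hd
    have h₁ := hd true
    have h₂ := hd false
    have := Finset.card_filter_add_card_filter_not (s := C) fun p ↦ p.right = true
    simp only [Bool.not_eq_true] at this
    omega
  let A := (C.filter fun p ↦ p.right = d).image Turn.lvl
  have hA : A ⊆ Finset.range N := by
    intro x hx
    obtain ⟨p, hp, rfl⟩ := Finset.mem_image.mp hx
    exact Finset.mem_range.mpr (hlvl p (Finset.mem_filter.mp hp).1)
  have hcard : 2 * t ≤ A.card := by
    rwa [Finset.card_image_of_injOn (h.injOn.mono <| Finset.coe_subset.mpr <|
      Finset.filter_subset _ _)]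
  obtain ⟨U, V, hU, hV, hUt, hVt, hdis, hdom⟩ := exists_dominates (φ := φ) (A := A) (t := t) (by
    intro x hx y hy z hz hxy hyz
    obtain ⟨p, hp, rfl⟩ := Finset.mem_image.mp hx
    obtain ⟨q, hq, rfl⟩ := Finset.mem_image.mp hy
    obtain ⟨r, hr, rfl⟩ := Finset.mem_image.mp hz
    rw [Finset.mem_filter] at hp hq hr
    have := h.not_forbidden hT hS hN hp.1 hq.1 hr.1 hxy hyz
    rwa [hq.2, hr.2, Forbidden.same] at this) hcard
  exact hφ U V (hU.trans hA) (hV.trans hA) hUt hVt hdis hdom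

theorem sq_floor_rpow_lt {n : ℕ} (hn : 5 ≤ n) :
    ⌊(2 : ℝ) ^ ((1 / 8 : ℝ) * (n : ℝ))⌋₊ ^ 2 < 2 ^ (n / 2) := by
  have h₁ : (⌊(2 : ℝ) ^ ((1 / 8 : ℝ) * (n : ℝ))⌋₊ : ℝ) ≤ (2 : ℝ) ^ ((1 / 8 : ℝ) * (n : ℝ)) :=
    Nat.floor_le (by positivity)
  have h₂ : (n : ℝ) ≤ 2 * ((n / 2 : ℕ) : ℝ) + 1 := by
    exact_mod_cast (by omega : n ≤ 2 * (n / 2) + 1)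
  have h₃ : (5 : ℝ) ≤ n := by exact_mod_cast hn
  have h₄ : (⌊(2 : ℝ) ^ ((1 / 8 : ℝ) * (n : ℝ))⌋₊ : ℝ) ^ 2 < (2 : ℝ) ^ (n / 2) := by
    calc (⌊(2 : ℝ) ^ ((1 / 8 : ℝ) * (n : ℝ))⌋₊ : ℝ) ^ 2
        ≤ ((2 : ℝ) ^ ((1 / 8 : ℝ) * (n : ℝ))) ^ 2 := by gcongr
      _ = (2 : ℝ) ^ ((1 / 4 : ℝ) * (n : ℝ)) := by
          rw [← Real.rpow_natCast, ← Real.rpow_mul (by norm_num)]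
          congr 1
          push_cast
          ring
      _ < (2 : ℝ) ^ ((n / 2 : ℕ) : ℝ) :=
          Real.rpow_lt_rpow_of_exponent_lt (by norm_num) (by linarith)
      _ = (2 : ℝ) ^ (n / 2) := Real.rpow_natCast _ _
  exact_mod_cast h₄

theorem exists_K5free_small_independence :
    ∃ c₀ : ℝ, 0 < c₀ ∧ ∀ n : ℕ, 5 ≤ n →
      ∃ E : Set (Finset ℕ),
        (∀ e ∈ E, e.card = 4 ∧ e ⊆ Finset.range (2 ^ ⌊(2 : ℝ) ^ (c₀ * (n : ℝ))⌋₊)) ∧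
        (∀ S : Finset ℕ, S ⊆ Finset.range (2 ^ ⌊(2 : ℝ) ^ (c₀ * (n : ℝ))⌋₊) →
          S.card = 5 → ¬ ∀ e, e ⊆ S → e.card = 4 → e ∈ E) ∧
        (∀ S : Finset ℕ, S ⊆ Finset.range (2 ^ ⌊(2 : ℝ) ^ (c₀ * (n : ℝ))⌋₊) →
          S.card = 2 ^ 6 * n ^ 5 + 1 → ∃ e ∈ E, e ⊆ S) := by
  refine ⟨1 / 8, by norm_num, fun n hn ↦ ?_⟩
  have hN := sq_floor_rpow_lt hn
  generalize ⌊(2 : ℝ) ^ ((1 / 8 : ℝ) * (n : ℝ))⌋₊ = N at hN ⊢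
  have ht : 0 < n / 2 := by omega
  obtain ⟨φ, hφ⟩ := exists_colouring ht hN
  refine ⟨stepUp φ N, fun e he ↦ stepUp.card_eq_and_subset he,
    fun S _ hS ↦ stepUp.exists_notMem hS, fun S hS hcard ↦ ?_⟩
  by_contra! hind
  have hle := IsPath.card_le_of_independent hind hS fun T C h hT ↦ h.card_lt hφ hind hS hT
  have : 2 * (4 * (n / 2)) ^ 5 ≤ 2 ^ 6 * n ^ 5 := by
    calc 2 * (4 * (n / 2)) ^ 5 ≤ 2 * (2 * n) ^ 5 :=
          Nat.mul_le_mul_left 2 (Nat.pow_le_pow_left (by omega) 5)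
      _ = 2 ^ 6 * n ^ 5 := by ring
  omega
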